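/- Let {i_1, …, i_m} ⊆ {0, …, n−1} with 1 < m ≤ n, let f = lclm{x − α_{i_1}, …, x − α_{i_m}}, and let f_1, …, f_m ∈ R be such that f = f_j (x − α_{i_j}) for all 1 ≤ j ≤ m. Then, under the P-independence hypothesis: (1) lcrm(f_1, …, f_m) = f and gcld(f_1, …, f_m) = 1; (2) R/fR = ⊕_{j=1}^m (f_j R / fR) as right R-modules; (3) for any h ∈ R with deg h < m there exist a_1, …, a_m ∈ L with h = Σ_{j=1}^m f_j a_j; (4) the classes of f_1, …, f_m modulo fR form a basis of R/fR as a right L-vector space. -/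

import Mathlib

/-- `δ` is a `σ`-derivation of the field `L`. -/
def IsSigmaDerivation {L : Type*} [Field L] (σ : L ≃+* L) (δ : L → L) : Prop :=
  (∀ a b : L, δ (a + b) = δ a + δ b) ∧ ∀ a b : L, δ (a * b) = σ a * δ b + δ a * b

/-- The ring `R`, together with the embedding of constants `C : L →+* R` and the
element `X`, is the Ore extension `L[x;σ,δ]`: the twisting rule
`X * C a = C (σ a) * X + C (δ a)` holds and every element of `R` is, in a unique way,
a left `L`-linear combination of the powers of `X`. -/
structure IsOreExtension {L : Type*} [Field L] (σ : L ≃+* L) (δ : L → L)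
    (R : Type*) [Ring R] (C : L →+* R) (X : R) : Prop where
  twist : ∀ a : L, X * C a = C (σ a) * X + C (δ a)
  repr_unique : ∀ r : R, ∃! f : ℕ →₀ L, r = f.sum fun n a => C a * X ^ n

/-- The degree of an Ore polynomial (`⊥` for the zero polynomial). -/
noncomputable def IsOreExtension.deg {L : Type*} [Field L] {σ : L ≃+* L} {δ : L → L}
    {R : Type*} [Ring R] {C : L →+* R} {X : R}
    (H : IsOreExtension σ δ R C X) (r : R) : WithBot ℕ :=
  (H.repr_unique r).exists.choose.support.max

/-- `f` is a right divisor of `g` : `g = u * f` for some `u`. -/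
def RDvd {R : Type*} [Ring R] (f g : R) : Prop := ∃ u, g = u * f

/-- `f` is a left divisor of `g` : `g = f * u` for some `u`. -/
def LDvd {R : Type*} [Ring R] (f g : R) : Prop := ∃ u, g = f * u

/-- `m` is a least common left multiple of the family `f`. -/
def IsLclm {R : Type*} [Ring R] {ι : Type*} (f : ι → R) (m : R) : Prop :=
  (∀ i, RDvd (f i) m) ∧ ∀ m' : R, (∀ i, RDvd (f i) m') → RDvd m m'

/-- `m` is a least common right multiple of the family `f`. -/
def IsLcrm {R : Type*} [Ring R] {ι : Type*} (f : ι → R) (m : R) : Prop :=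
  (∀ i, LDvd (f i) m) ∧ ∀ m' : R, (∀ i, LDvd (f i) m') → LDvd m m'

/-- `gcld (f, g) = 1`, i.e. `fR + gR = R`. -/
def LCoprime {R : Type*} [Ring R] (f g : R) : Prop := ∃ a b : R, f * a + g * b = 1

/-- `gcrd (f, g) = 1`, i.e. `Rf + Rg = R`. -/
def RCoprime {R : Type*} [Ring R] (f g : R) : Prop := ∃ a b : R, a * f + b * g = 1

namespace IsOreExtension

section

variable {L : Type*} [Field L] {σ : L ≃+* L} {δ : L → L} {R : Type*} [Ring R] {C : L →+* R} {X : R}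

/-- The left coefficients of an Ore polynomial. -/
noncomputable def coeff (H : IsOreExtension σ δ R C X) (r : R) : ℕ →₀ L :=
  (H.repr_unique r).exists.choose

theorem sum_coeff (H : IsOreExtension σ δ R C X) (r : R) :
    r = (H.coeff r).sum fun n a => C a * X ^ n :=
  (H.repr_unique r).exists.choose_spec

theorem coeff_eq (H : IsOreExtension σ δ R C X) {r : R} {g : ℕ →₀ L}
    (h : r = g.sum fun n a => C a * X ^ n) : H.coeff r = g :=
  (H.repr_unique r).unique (H.sum_coeff r) h

theorem coeff_add (H : IsOreExtension σ δ R C X) (r s : R) :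
    H.coeff (r + s) = H.coeff r + H.coeff s := by
  apply H.coeff_eq
  rw [Finsupp.sum_add_index' (by simp) (by simp [add_mul]), ← H.sum_coeff, ← H.sum_coeff]

theorem coeff_C_mul (H : IsOreExtension σ δ R C X) (a : L) (r : R) :
    H.coeff (C a * r) = a • H.coeff r := by
  apply H.coeff_eq
  rw [Finsupp.sum_smul_index (by simp)]
  conv_lhs => rw [H.sum_coeff r]
  simp [Finsupp.sum, Finset.mul_sum, mul_assoc]

theorem coeff_C_mul_X_pow (H : IsOreExtension σ δ R C X) (a : L) (k : ℕ) :
    H.coeff (C a * X ^ k) = Finsupp.single k a := by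
  apply H.coeff_eq
  simp

theorem coeff_mul_X (H : IsOreExtension σ δ R C X) (r : R) :
    H.coeff (r * X) = (H.coeff r).embDomain ⟨Nat.succ, Nat.succ_injective⟩ := by
  apply H.coeff_eq
  rw [Finsupp.sum_embDomain]
  conv_lhs => rw [H.sum_coeff r]
  simp [Finsupp.sum, Finset.sum_mul, mul_assoc, pow_succ]

/-- `H.DegLT k r` says that the Ore polynomial `r` has degree less than `k`. -/
def DegLT (H : IsOreExtension σ δ R C X) (k : ℕ) (r : R) : Prop :=
  ∀ n, k ≤ n → H.coeff r n = 0

/-- `H.HasLead k a r` says that `r = a X ^ k + (terms of degree less than k)`. -/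
def HasLead (H : IsOreExtension σ δ R C X) (k : ℕ) (a : L) (r : R) : Prop :=
  ∃ s, H.DegLT k s ∧ r = C a * X ^ k + s

theorem deg_lt_iff (H : IsOreExtension σ δ R C X) (r : R) (k : ℕ) :
    H.deg r < (k : WithBot ℕ) ↔ H.DegLT k r := by
  have hd : H.deg r = (H.coeff r).support.max := rfl
  rw [hd, Finset.max_eq_sup_withBot]
  refine (Finset.sup_lt_iff (a := (k : WithBot ℕ)) (WithBot.bot_lt_coe k)).trans ?_
  constructor
  · intro h n hn
    by_contra h0
    exact absurd (Nat.cast_lt.1 (h n (Finsupp.mem_support_iff.2 h0))) (not_lt.2 hn)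
  · intro h n hn
    by_contra h0
    exact (Finsupp.mem_support_iff.1 hn) (h n (not_lt.1 fun hlt => h0 (Nat.cast_lt.2 hlt)))

theorem degLT_zero_iff (H : IsOreExtension σ δ R C X) {r : R} : H.DegLT 0 r ↔ r = 0 := by
  constructor
  · intro h
    have h0 : H.coeff r = 0 := Finsupp.ext fun n => h n (Nat.zero_le n)
    rw [H.sum_coeff r, h0]
    simp
  · rintro rfl n -
    have h0 : H.coeff (0 : R) = 0 := H.coeff_eq (by simp)
    simp [h0]

theorem degLT_zero (H : IsOreExtension σ δ R C X) (k : ℕ) : H.DegLT k (0 : R) :=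
  fun n _ => H.degLT_zero_iff.2 rfl n (Nat.zero_le n)

theorem DegLT.mono {H : IsOreExtension σ δ R C X} {k l : ℕ} {r : R} (h : H.DegLT k r)
    (hkl : k ≤ l) : H.DegLT l r :=
  fun n hn => h n (hkl.trans hn)

theorem DegLT.add {H : IsOreExtension σ δ R C X} {k : ℕ} {r s : R} (hr : H.DegLT k r)
    (hs : H.DegLT k s) : H.DegLT k (r + s) := by
  intro n hn
  simp [H.coeff_add, hr n hn, hs n hn]

theorem DegLT.C_mul {H : IsOreExtension σ δ R C X} {k : ℕ} {r : R} (hr : H.DegLT k r) (a : L) :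
    H.DegLT k (C a * r) := by
  intro n hn
  simp [H.coeff_C_mul, hr n hn]

theorem DegLT.neg {H : IsOreExtension σ δ R C X} {k : ℕ} {r : R} (hr : H.DegLT k r) :
    H.DegLT k (-r) := by
  simpa using hr.C_mul (-1)

theorem DegLT.sub {H : IsOreExtension σ δ R C X} {k : ℕ} {r s : R} (hr : H.DegLT k r)
    (hs : H.DegLT k s) : H.DegLT k (r - s) := by
  rw [sub_eq_add_neg]
  exact hr.add hs.neg

theorem DegLT.sum {H : IsOreExtension σ δ R C X} {k : ℕ} {ι : Type*} (t : Finset ι) {g : ι → R}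
    (h : ∀ i ∈ t, H.DegLT k (g i)) : H.DegLT k (∑ i ∈ t, g i) :=
  Finset.sum_induction g (H.DegLT k) (fun _ _ => DegLT.add) (H.degLT_zero k) h

theorem degLT_C_mul_X_pow (H : IsOreExtension σ δ R C X) (a : L) (k : ℕ) :
    H.DegLT (k + 1) (C a * X ^ k) := by
  intro n hn
  rw [H.coeff_C_mul_X_pow, Finsupp.single_eq_of_ne (by omega)]

theorem DegLT.mul_X {H : IsOreExtension σ δ R C X} {k : ℕ} {r : R} (hr : H.DegLT k r) :
    H.DegLT (k + 1) (r * X) := by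
  intro n hn
  obtain ⟨n, rfl⟩ : ∃ p, n = p + 1 := ⟨n - 1, by omega⟩
  rw [H.coeff_mul_X]
  exact (Finsupp.embDomain_apply_self ⟨Nat.succ, Nat.succ_injective⟩ _ n).trans
    (hr n (by omega))

theorem DegLT.mul_X_pow {H : IsOreExtension σ δ R C X} {k : ℕ} {r : R} (hr : H.DegLT k r)
    (l : ℕ) : H.DegLT (k + l) (r * X ^ l) := by
  induction l with
  | zero => simpa using hr
  | succ l ih =>
    rw [pow_succ, ← mul_assoc]
    exact ih.mul_X

theorem exists_degLT (H : IsOreExtension σ δ R C X) (r : R) : ∃ k, H.DegLT k r := by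
  refine ⟨(H.coeff r).support.sup id + 1, fun n hn => ?_⟩
  by_contra h0
  have := Finset.le_sup (f := id) (Finsupp.mem_support_iff.2 h0)
  simp only [id] at this
  omega

theorem DegLT.exists_hasLead {H : IsOreExtension σ δ R C X} {k : ℕ} {r : R}
    (hr : H.DegLT (k + 1) r) : ∃ a, H.HasLead k a r := by
  refine ⟨H.coeff r k, r - C (H.coeff r k) * X ^ k, fun n hn => ?_, by abel⟩
  have hadd := H.coeff_add (C (H.coeff r k) * X ^ k) (r - C (H.coeff r k) * X ^ k)
  rw [add_sub_cancel, H.coeff_C_mul_X_pow] at hadd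
  have hn' := DFunLike.congr_fun hadd n
  rw [Finsupp.add_apply] at hn'
  rcases eq_or_lt_of_le hn with rfl | hlt
  · simpa using hn'
  · rw [hr n hlt, Finsupp.single_eq_of_ne (by omega), zero_add] at hn'
    exact hn'.symm

theorem HasLead.degLT {H : IsOreExtension σ δ R C X} {k : ℕ} {a : L} {r : R}
    (hr : H.HasLead k a r) : H.DegLT (k + 1) r := by
  obtain ⟨s, hs, rfl⟩ := hr
  exact (H.degLT_C_mul_X_pow a k).add (hs.mono k.le_succ)

theorem HasLead.coeff_eq {H : IsOreExtension σ δ R C X} {k : ℕ} {a : L} {r : R}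
    (hr : H.HasLead k a r) : H.coeff r k = a := by
  obtain ⟨s, hs, rfl⟩ := hr
  simp [H.coeff_add, H.coeff_C_mul_X_pow, hs k le_rfl]

theorem HasLead.degLT_of_zero {H : IsOreExtension σ δ R C X} {k : ℕ} {r : R}
    (hr : H.HasLead k 0 r) : H.DegLT k r := by
  obtain ⟨s, hs, rfl⟩ := hr
  simpa using hs

theorem HasLead.add {H : IsOreExtension σ δ R C X} {k : ℕ} {a : L} {r s : R}
    (hr : H.HasLead k a r) (hs : H.DegLT k s) : H.HasLead k a (r + s) := by
  obtain ⟨t, ht, rfl⟩ := hr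
  exact ⟨t + s, ht.add hs, add_assoc _ _ _⟩

theorem HasLead.sub {H : IsOreExtension σ δ R C X} {k : ℕ} {a : L} {r s : R}
    (hr : H.HasLead k a r) (hs : H.HasLead k a s) : H.DegLT k (r - s) := by
  obtain ⟨t, ht, rfl⟩ := hr
  obtain ⟨u, hu, rfl⟩ := hs
  rw [add_sub_add_left_eq_sub]
  exact ht.sub hu

theorem HasLead.lt_of_degLT {H : IsOreExtension σ δ R C X} {k l : ℕ} {a : L} {r : R}
    (hr : H.HasLead k a r) (ha : a ≠ 0) (h : H.DegLT l r) : k < l := by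
  by_contra hlt
  exact ha (hr.coeff_eq ▸ h k (not_lt.1 hlt))

theorem HasLead.degree_unique {H : IsOreExtension σ δ R C X} {k l : ℕ} {a b : L} {r : R}
    (hr : H.HasLead k a r) (ha : a ≠ 0) (hr' : H.HasLead l b r) (hb : b ≠ 0) : k = l := by
  have h1 := hr.lt_of_degLT ha hr'.degLT
  have h2 := hr'.lt_of_degLT hb hr.degLT
  omega

theorem HasLead.ne_zero {H : IsOreExtension σ δ R C X} {k : ℕ} {a : L} {r : R}
    (hr : H.HasLead k a r) (ha : a ≠ 0) : r ≠ 0 := fun h =>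
  absurd (hr.lt_of_degLT ha (H.degLT_zero_iff.2 h)) (Nat.not_lt_zero k)

theorem DegLT.exists_hasLead_ne_zero {H : IsOreExtension σ δ R C X} {k : ℕ} {r : R}
    (hr : H.DegLT k r) (h0 : r ≠ 0) : ∃ l < k, ∃ a ≠ 0, H.HasLead l a r := by
  induction k with
  | zero => exact absurd (H.degLT_zero_iff.1 hr) h0
  | succ k ih =>
    obtain ⟨a, ha⟩ := hr.exists_hasLead
    by_cases ha0 : a = 0
    · subst ha0
      obtain ⟨l, hl, h⟩ := ih ha.degLT_of_zero
      exact ⟨l, by omega, h⟩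
    · exact ⟨k, by omega, a, ha0, ha⟩

theorem exists_hasLead (H : IsOreExtension σ δ R C X) {r : R} (h0 : r ≠ 0) :
    ∃ l, ∃ a ≠ 0, H.HasLead l a r := by
  obtain ⟨k, hk⟩ := H.exists_degLT r
  obtain ⟨l, -, h⟩ := hk.exists_hasLead_ne_zero h0
  exact ⟨l, h⟩

theorem hasLead_X_pow_mul_C (H : IsOreExtension σ δ R C X) (k : ℕ) (b : L) :
    H.HasLead k (σ^[k] b) (X ^ k * C b) := by
  induction k generalizing b with
  | zero => exact ⟨0, H.degLT_zero 0, by simp⟩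
  | succ k ih =>
    obtain ⟨s, hs, h⟩ := ih (σ b)
    refine ⟨s * X + X ^ k * C (δ b), hs.mul_X.add (ih (δ b)).degLT, ?_⟩
    rw [pow_succ, mul_assoc, H.twist, mul_add, ← mul_assoc, h, Function.iterate_succ_apply]
    rw [add_mul, mul_assoc (C _), add_assoc]

theorem HasLead.mul_C {H : IsOreExtension σ δ R C X} {k : ℕ} {a : L} {r : R}
    (hr : H.HasLead k a r) (b : L) : H.HasLead k (a * σ^[k] b) (r * C b) := by
  induction k generalizing a r with
  | zero =>
    obtain ⟨s, hs, rfl⟩ := hr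
    rw [H.degLT_zero_iff.1 hs]
    exact ⟨0, H.degLT_zero 0, by simp⟩
  | succ k ih =>
    obtain ⟨s, hs, rfl⟩ := hr
    obtain ⟨t, ht, h⟩ := H.hasLead_X_pow_mul_C (k + 1) b
    obtain ⟨c, hc⟩ := hs.exists_hasLead
    refine ⟨C a * t + s * C b, (ht.C_mul a).add (ih hc).degLT, ?_⟩
    rw [add_mul, mul_assoc, h, map_mul, mul_add, add_assoc, mul_assoc]

theorem HasLead.mul_C_mul_X_pow {H : IsOreExtension σ δ R C X} {k : ℕ} {a : L} {r : R}
    (hr : H.HasLead k a r) (b : L) (l : ℕ) :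
    H.HasLead (k + l) (a * σ^[k] b) (r * (C b * X ^ l)) := by
  obtain ⟨s, hs, h⟩ := hr.mul_C b
  exact ⟨s * X ^ l, hs.mul_X_pow l, by rw [← mul_assoc, h, add_mul, mul_assoc, pow_add]⟩

theorem HasLead.mul_degLT {H : IsOreExtension σ δ R C X} {k l : ℕ} {a : L} {r s : R}
    (hr : H.HasLead k a r) (hs : H.DegLT l s) : H.DegLT (k + l) (r * s) := by
  induction l generalizing s with
  | zero =>
    rw [H.degLT_zero_iff.1 hs, mul_zero]
    exact H.degLT_zero _
  | succ l ih =>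
    obtain ⟨b, t, ht, rfl⟩ := hs.exists_hasLead
    rw [mul_add]
    exact (hr.mul_C_mul_X_pow b l).degLT.add ((ih ht).mono (by omega))

theorem HasLead.mul {H : IsOreExtension σ δ R C X} {k l : ℕ} {a b : L} {r s : R}
    (hr : H.HasLead k a r) (hs : H.HasLead l b s) :
    H.HasLead (k + l) (a * σ^[k] b) (r * s) := by
  obtain ⟨t, ht, rfl⟩ := hs
  rw [mul_add]
  exact (hr.mul_C_mul_X_pow b l).add (hr.mul_degLT ht)

theorem DegLT.mul_C {H : IsOreExtension σ δ R C X} {k : ℕ} {r : R} (hr : H.DegLT k r) (b : L) :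
    H.DegLT k (r * C b) := by
  cases k with
  | zero => simpa [H.degLT_zero_iff.1 hr] using H.degLT_zero 0
  | succ k =>
    obtain ⟨a, ha⟩ := hr.exists_hasLead
    exact (ha.mul_C b).degLT

theorem iterate_ne_zero (σ : L ≃+* L) (k : ℕ) {a : L} (ha : a ≠ 0) : σ^[k] a ≠ 0 := by
  intro h
  exact ha (σ.injective.iterate k (h.trans (iterate_map_zero σ k).symm))

theorem HasLead.eq_zero_of_mul_degLT {H : IsOreExtension σ δ R C X} {k : ℕ} {a : L} {r s : R}
    (hr : H.HasLead k a r) (ha : a ≠ 0) (h : H.DegLT k (r * s)) : s = 0 := by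
  by_contra hs
  obtain ⟨l, b, hb, hl⟩ := H.exists_hasLead hs
  have := (hr.mul hl).lt_of_degLT (mul_ne_zero ha (iterate_ne_zero σ k hb)) h
  omega

theorem HasLead.eq_zero_of_degLT_mul {H : IsOreExtension σ δ R C X} {k : ℕ} {a : L} {r s : R}
    (hr : H.HasLead k a r) (ha : a ≠ 0) (h : H.DegLT k (s * r)) : s = 0 := by
  by_contra hs
  obtain ⟨l, b, hb, hl⟩ := H.exists_hasLead hs
  have := (hl.mul hr).lt_of_degLT (mul_ne_zero hb (iterate_ne_zero σ l ha)) h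
  omega

theorem noZeroDivisors (H : IsOreExtension σ δ R C X) : NoZeroDivisors R where
  eq_zero_or_eq_zero_of_mul_eq_zero {r s} h := by
    by_contra! h0
    obtain ⟨k, a, ha, hk⟩ := H.exists_hasLead h0.1
    exact h0.2 (hk.eq_zero_of_mul_degLT ha (h ▸ H.degLT_zero k))

theorem HasLead.exists_left_div {H : IsOreExtension σ δ R C X} {k : ℕ} {a : L} {d : R}
    (hd : H.HasLead k a d) (ha : a ≠ 0) (g : R) : ∃ q, H.DegLT k (g - d * q) := by
  obtain ⟨l, hl⟩ := H.exists_degLT g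
  induction l generalizing g with
  | zero => exact ⟨0, by simpa using hl.mono (Nat.zero_le k)⟩
  | succ l ih =>
    by_cases hkl : l + 1 ≤ k
    · exact ⟨0, by simpa using hl.mono hkl⟩
    obtain ⟨b, hb⟩ := hl.exists_hasLead
    obtain ⟨c, hc⟩ := σ.surjective.iterate k (a⁻¹ * b)
    have hm := hd.mul_C_mul_X_pow c (l - k)
    rw [hc, mul_inv_cancel_left₀ ha, Nat.add_sub_cancel' (by omega)] at hm
    obtain ⟨q, hq⟩ := ih _ (hb.sub hm)
    exact ⟨C c * X ^ (l - k) + q, by rwa [mul_add, ← sub_sub]⟩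

theorem hasLead_X_sub_C (H : IsOreExtension σ δ R C X) (a : L) : H.HasLead 1 1 (X - C a) := by
  refine ⟨C (-a) * X ^ 0, H.degLT_C_mul_X_pow (-a) 0, ?_⟩
  simp [sub_eq_add_neg]

theorem DegLT.exists_eq_C {H : IsOreExtension σ δ R C X} {r : R} (hr : H.DegLT 1 r) :
    ∃ c, r = C c := by
  obtain ⟨c, s, hs, h⟩ := hr.exists_hasLead
  exact ⟨c, by simpa [H.degLT_zero_iff.1 hs] using h⟩

theorem exists_eq_X_sub_C_mul_add_C (H : IsOreExtension σ δ R C X) (a : L) (g : R) :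
    ∃ q c, g = (X - C a) * q + C c := by
  obtain ⟨q, hq⟩ := (H.hasLead_X_sub_C a).exists_left_div one_ne_zero g
  obtain ⟨c, hc⟩ := hq.exists_eq_C
  exact ⟨q, c, by rw [← hc]; abel⟩

theorem exists_eq_mul_X_sub_C_add_C (H : IsOreExtension σ δ R C X) (a : L) (g : R) :
    ∃ q c, g = q * (X - C a) + C c := by
  obtain ⟨l, hl⟩ := H.exists_degLT g
  induction l generalizing g with
  | zero => exact ⟨0, 0, by simpa using H.degLT_zero_iff.1 hl⟩
  | succ l ih =>
    obtain ⟨b, hb⟩ := hl.exists_hasLead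
    cases l with
    | zero =>
      obtain ⟨c, hc⟩ := hl.exists_eq_C
      exact ⟨0, c, by simpa using hc⟩
    | succ l =>
      have hbl : H.HasLead l b (C b * X ^ l) := ⟨0, H.degLT_zero l, by simp⟩
      have hm := hbl.mul (H.hasLead_X_sub_C a)
      rw [iterate_map_one, mul_one] at hm
      obtain ⟨q, c, hq⟩ := ih _ (hb.sub hm)
      exact ⟨C b * X ^ l + q, c, by rw [add_mul, add_assoc, ← hq]; abel⟩

/-- Every nonzero Ore polynomial `g` has a nonzero left multiple vanishing at `a` whose degree
exceeds that of `g` by at most one. -/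
theorem HasLead.exists_rdvd_X_sub_C {H : IsOreExtension σ δ R C X} {k : ℕ} {b : L} {g : R}
    (hg : H.HasLead k b g) (hb : b ≠ 0) (a : L) :
    ∃ g', RDvd g g' ∧ RDvd (X - C a) g' ∧ ∃ l ≤ k + 1, ∃ c ≠ 0, H.HasLead l c g' := by
  obtain ⟨q, r, hr⟩ := H.exists_eq_mul_X_sub_C_add_C a g
  by_cases hr0 : r = 0
  · exact ⟨g, ⟨1, by simp⟩, ⟨q, by simpa [hr0] using hr⟩, k, by omega, b, hb, hg⟩
  set β := (σ r * a + δ r) * r⁻¹ with hβ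
  refine ⟨(X - C β) * g, ⟨_, rfl⟩, ⟨(X - C β) * q + C (σ r), ?_⟩, 1 + k, by omega, _, ?_,
    (H.hasLead_X_sub_C β).mul hg⟩
  · have hβr : β * r = σ r * a + δ r := by rw [hβ, inv_mul_cancel_right₀ hr0]
    have h1 : (X - C β) * C r = C (σ r) * (X - C a) := by
      rw [sub_mul, H.twist, ← map_mul, hβr, mul_sub, map_add, map_mul]
      abel
    rw [add_mul, ← h1, mul_assoc, ← mul_add, ← hr]
  · exact mul_ne_zero one_ne_zero (iterate_ne_zero σ 1 hb)

theorem _root_.RDvd.trans {f g h : R} (h1 : RDvd f g) (h2 : RDvd g h) : RDvd f h := by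
  obtain ⟨u, rfl⟩ := h1
  obtain ⟨v, rfl⟩ := h2
  exact ⟨v * u, by rw [mul_assoc]⟩

theorem HasLead.exists_rdvd_forall_X_sub_C {H : IsOreExtension σ δ R C X} {k : ℕ} {b : L} {g : R}
    (hg : H.HasLead k b g) (hb : b ≠ 0) {ι : Type*} (α : ι → L) (t : Finset ι) :
    ∃ g', RDvd g g' ∧ (∀ i ∈ t, RDvd (X - C (α i)) g') ∧
      ∃ l ≤ k + t.card, ∃ c ≠ 0, H.HasLead l c g' := by
  classical
  induction t using Finset.induction_on with
  | empty => exact ⟨g, ⟨1, by simp⟩, by simp, k, by simp, b, hb, hg⟩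
  | insert i t hi ih =>
    obtain ⟨g', h1, h2, l, hl, c, hc, hlc⟩ := ih
    obtain ⟨g'', h1', h2', l', hl', hlc'⟩ := hlc.exists_rdvd_X_sub_C hc (α i)
    refine ⟨g'', h1.trans h1', fun j hj => ?_, l', ?_, hlc'⟩
    · rcases Finset.mem_insert.1 hj with rfl | hj
      · exact h2'
      · exact (h2 j hj).trans h1'
    · rw [Finset.card_insert_of_notMem hi]
      omega

theorem hasLead_one (H : IsOreExtension σ δ R C X) : H.HasLead 0 1 (1 : R) :=
  ⟨0, H.degLT_zero 0, by simp⟩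

theorem HasLead.le_of_rdvd {H : IsOreExtension σ δ R C X} {k l : ℕ} {a b : L} {r s : R}
    (hr : H.HasLead k a r) (ha : a ≠ 0) (hs : H.HasLead l b s) (hb : b ≠ 0) (h : RDvd r s) :
    k ≤ l := by
  obtain ⟨u, rfl⟩ := h
  by_contra hlt
  have h0 := hr.eq_zero_of_degLT_mul ha (hs.degLT.mono (not_le.1 hlt))
  exact hs.ne_zero hb (by rw [h0, zero_mul])

theorem exists_hasLead_of_deg_eq (H : IsOreExtension σ δ R C X) {r : R} {n : ℕ}
    (h : H.deg r = (n : WithBot ℕ)) : ∃ a ≠ 0, H.HasLead n a r := by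
  have h1 : H.DegLT (n + 1) r :=
    (H.deg_lt_iff r (n + 1)).1 (h ▸ Nat.cast_lt.2 n.lt_succ_self)
  obtain ⟨a, ha⟩ := h1.exists_hasLead
  refine ⟨a, ?_, ha⟩
  rintro rfl
  exact lt_irrefl _ (h ▸ (H.deg_lt_iff r n).2 ha.degLT_of_zero)

/-- Under P-independence, the least common left multiple of `m` of the given linear
polynomials has degree `m`. -/
theorem exists_hasLead_of_isLclm (H : IsOreExtension σ δ R C X) {n : ℕ} {α : Fin n → L} {Λ : R}
    (hΛ : IsLclm (fun i => X - C (α i)) Λ) (hdeg : H.deg Λ = (n : WithBot ℕ))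
    {m : ℕ} {ι : Fin m → Fin n} (hι : Function.Injective ι)
    {f : R} (hf : IsLclm (fun j => X - C (α (ι j))) f) : ∃ a ≠ 0, H.HasLead m a f := by
  obtain ⟨g, -, hg, l, hl, c, hc, hlc⟩ :=
    H.hasLead_one.exists_rdvd_forall_X_sub_C one_ne_zero (fun j => α (ι j)) Finset.univ
  have hfg : RDvd f g := hf.2 g fun j => hg j (Finset.mem_univ j)
  have hf0 : f ≠ 0 := by
    rintro rfl
    obtain ⟨u, hu⟩ := hfg
    exact hlc.ne_zero hc (by rw [hu, mul_zero])
  obtain ⟨k, a, ha, hk⟩ := H.exists_hasLead hf0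
  have hkl := hk.le_of_rdvd ha hlc hc hfg
  obtain ⟨g', hfg', hg', l', hl', c', hc', hlc'⟩ :=
    hk.exists_rdvd_forall_X_sub_C ha α (Finset.univ.image ι)ᶜ
  obtain ⟨b, hb, hΛn⟩ := H.exists_hasLead_of_deg_eq hdeg
  have hle : n ≤ l' := hΛn.le_of_rdvd hb hlc' hc' <| hΛ.2 g' fun i => by
    by_cases hi : i ∈ Finset.univ.image ι
    · obtain ⟨j, -, rfl⟩ := Finset.mem_image.1 hi
      exact (hf.1 j).trans hfg'
    · exact hg' i (Finset.mem_compl.2 hi)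
  rw [Finset.card_compl, Finset.card_image_of_injective _ hι] at hl'
  have hmn := Fintype.card_le_of_injective ι hι
  simp only [Finset.card_univ, Fintype.card_fin] at hl hl' hmn
  obtain rfl : k = m := by omega
  exact ⟨a, ha, hk⟩

theorem DegLT.exists_eq_sum_X_pow_mul_C {H : IsOreExtension σ δ R C X} {m : ℕ} {r : R}
    (hr : H.DegLT m r) : ∃ v : Fin m → L, r = ∑ i : Fin m, X ^ (i : ℕ) * C (v i) := by
  induction m generalizing r with
  | zero => exact ⟨0, by simpa using H.degLT_zero_iff.1 hr⟩
  | succ m ih =>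
    obtain ⟨a, ha⟩ := hr.exists_hasLead
    obtain ⟨b, rfl⟩ := σ.surjective.iterate m a
    obtain ⟨v, hv⟩ := ih (ha.sub (H.hasLead_X_pow_mul_C m b))
    refine ⟨Fin.snoc v b, ?_⟩
    rw [Fin.sum_univ_castSucc]
    simp only [Fin.snoc_castSucc, Fin.snoc_last, Fin.val_castSucc, Fin.val_last]
    rw [← hv]
    abel

theorem eq_zero_of_sum_X_pow_mul_C_eq_zero (H : IsOreExtension σ δ R C X) {m : ℕ} {v : Fin m → L}
    (h : ∑ i : Fin m, X ^ (i : ℕ) * C (v i) = 0) : v = 0 := by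
  induction m with
  | zero => exact Subsingleton.elim _ _
  | succ m ih =>
    have hlow : H.DegLT m (∑ i : Fin m, X ^ (i : ℕ) * C (v i.castSucc)) :=
      DegLT.sum _ fun i _ => (H.hasLead_X_pow_mul_C i _).degLT.mono i.2
    rw [Fin.sum_univ_castSucc] at h
    simp only [Fin.val_castSucc, Fin.val_last] at h
    have hlast : v (Fin.last m) = 0 := by
      by_contra h0
      have := (H.hasLead_X_pow_mul_C m (v (Fin.last m))).add hlow
      exact this.ne_zero (iterate_ne_zero σ m h0) (by rw [add_comm, h])
    rw [hlast, map_zero, mul_zero, add_zero] at h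
    have h0 := ih h
    funext i
    refine Fin.lastCases hlast (fun j => congrFun h0 j) i

/-- If `m` Ore polynomials of degree less than `m` generate all Ore polynomials of degree less
than `m` under right linear combinations, they are right linearly independent. -/
theorem eq_zero_of_sum_mul_C_eq_zero (H : IsOreExtension σ δ R C X) {m : ℕ} {g : Fin m → R}
    (hg : ∀ j, H.DegLT m (g j))
    (hspan : ∀ z, H.DegLT m z → ∃ a : Fin m → L, z = ∑ j, g j * C (a j))
    {a : Fin m → L} (ha : ∑ j, g j * C (a j) = 0) : a = 0 := by
  choose B hB using fun j => (hg j).exists_eq_sum_X_pow_mul_C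
  have hX : ∀ i : Fin m, H.DegLT m (X ^ (i : ℕ)) := fun i => by
    simpa using (H.degLT_C_mul_X_pow 1 (i : ℕ)).mono i.2
  choose A hA using fun i => hspan _ (hX i)
  have hcomb : ∀ v : Fin m → L, ∑ j, g j * C (v j) =
      ∑ i : Fin m, X ^ (i : ℕ) * C (Matrix.mulVec (Matrix.of B).transpose v i) := by
    intro v
    simp only [Matrix.mulVec, dotProduct, Matrix.transpose_apply, Matrix.of_apply, map_sum,
      map_mul, Finset.mul_sum]
    rw [Finset.sum_comm]
    refine Finset.sum_congr rfl fun j _ => ?_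
    conv_lhs => rw [hB j]
    rw [Finset.sum_mul]
    exact Finset.sum_congr rfl fun i _ => mul_assoc _ _ _
  have hBA : (Matrix.of B).transpose * (Matrix.of A).transpose = 1 := by
    ext i k
    have hk : ∑ i : Fin m, X ^ (i : ℕ) *
        C (Matrix.mulVec (Matrix.of B).transpose (A k) i - (Pi.single k 1 : Fin m → L) i) = 0 := by
      simp only [map_sub, mul_sub, Finset.sum_sub_distrib]
      rw [← hcomb, ← hA k, Finset.sum_eq_single k]
      · simp
      · intro i _ hik
        simp [hik]
      · simp
    have hi := congrFun (H.eq_zero_of_sum_X_pow_mul_C_eq_zero hk) i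
    have hi' := sub_eq_zero.1 hi
    rw [Matrix.one_apply, ← Pi.single_apply]
    exact hi'
  have hB0 := H.eq_zero_of_sum_X_pow_mul_C_eq_zero ((hcomb a).symm.trans ha)
  have := congrArg (Matrix.mulVec (Matrix.of A).transpose) hB0
  rwa [Matrix.mulVec_mulVec, mul_eq_one_comm.1 hBA, Matrix.one_mulVec, Matrix.mulVec_zero] at this

/-- The left cofactors of a nonzero least common left multiple generate `R` as a right ideal. -/
theorem exists_sum_mul_eq_one (H : IsOreExtension σ δ R C X) {ι : Type*} [Fintype ι] [Nonempty ι]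
    {p fj : ι → R} {f : R} (hf : IsLclm p f) (hf0 : f ≠ 0) (hfj : ∀ j, f = fj j * p j) :
    ∃ a : ι → R, ∑ j, fj j * a j = 1 := by
  classical
  have := H.noZeroDivisors
  let I : R → Prop := fun z => ∃ a : ι → R, ∑ j, fj j * a j = z
  have hI : ∀ j, I (fj j) := fun j => ⟨Pi.single j 1, by
    rw [Finset.sum_eq_single j]
    · simp
    · intro i _ hij
      simp [hij]
    · simp⟩
  have hImul : ∀ z w, I z → I (z * w) := by
    rintro _ w ⟨a, rfl⟩
    exact ⟨fun j => a j * w, by simp [Finset.sum_mul, mul_assoc]⟩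
  have hIsub : ∀ z w, I z → I w → I (z - w) := by
    rintro _ _ ⟨a, rfl⟩ ⟨b, rfl⟩
    exact ⟨fun j => a j - b j, by simp [mul_sub, Finset.sum_sub_distrib]⟩
  obtain ⟨j₀⟩ := ‹Nonempty ι›
  have hex : ∃ k, ∃ d a, I d ∧ a ≠ 0 ∧ H.HasLead k a d := by
    have h0 : fj j₀ ≠ 0 := fun h => hf0 (by rw [hfj j₀, h, zero_mul])
    obtain ⟨k, a, ha, hk⟩ := H.exists_hasLead h0
    exact ⟨k, fj j₀, a, hI j₀, ha, hk⟩
  obtain ⟨d, a, hd, ha, hk⟩ := Nat.find_spec hex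
  have hdvd : ∀ j, ∃ q, fj j = d * q := fun j => by
    obtain ⟨q, hq⟩ := hk.exists_left_div ha (fj j)
    refine ⟨q, sub_eq_zero.1 ?_⟩
    by_contra h0
    obtain ⟨l, hl, b, hb, hlb⟩ := hq.exists_hasLead_ne_zero h0
    exact Nat.find_min hex hl ⟨_, b, hIsub _ _ (hI j) (hImul _ _ hd), hb, hlb⟩
  choose q hq using hdvd
  have hd0 := hk.ne_zero ha
  obtain ⟨v, hv⟩ := hf.2 (q j₀ * p j₀) fun j => ⟨q j, mul_left_cancel₀ hd0 <| by
    rw [← mul_assoc, ← hq, ← hfj, ← mul_assoc, ← hq, ← hfj]⟩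
  have hdv : d * v = 1 := mul_right_cancel₀ hf0 <| by
    rw [mul_assoc, ← hv, ← mul_assoc, ← hq, ← hfj, one_mul]
  exact hdv ▸ hImul d v hd

end

end IsOreExtension

/-- Lemma 10 of the paper: for a P-independent family of positional points, if
`f = lclm {x - α (ι 1), …, x - α (ι m)}` and `f = fj j * (x - α (ι j))`, then
`lcrm (fj 1, …, fj m) = f`, `gcld (fj 1, …, fj m) = 1`, `R/fR` is the (internal)
direct sum of the right submodules `fj j · R / fR`, every `h` with `deg h < m` is a
right `L`-combination of the `fj j`, and the classes of the `fj j` form a right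
`L`-basis of `R/fR`. -/
theorem lclm_cofactors_basis
    {L : Type*} [Field L] (σ : L ≃+* L) (δ : L → L) (hδ : IsSigmaDerivation σ δ)
    {R : Type*} [Ring R] (C : L →+* R) (X : R) (H : IsOreExtension σ δ R C X)
    (n : ℕ) (α : Fin n → L) (hα : Function.Injective α)
    (Pind : ∃ Λ : R, IsLclm (fun i : Fin n => X - C (α i)) Λ ∧ H.deg Λ = (n : WithBot ℕ))
    (m : ℕ) (hm1 : 1 < m) (hmn : m ≤ n) (ι : Fin m → Fin n) (hι : Function.Injective ι)
    (f : R) (hf : IsLclm (fun j : Fin m => X - C (α (ι j))) f)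
    (fj : Fin m → R) (hfj : ∀ j, f = fj j * (X - C (α (ι j)))) :
    (IsLcrm fj f ∧ (∃ a : Fin m → R, ∑ j, fj j * a j = 1)) ∧
    ((∀ z : R, ∃ (b : Fin m → R) (cc : R), z = (∑ j, fj j * b j) + f * cc) ∧
      (∀ b : Fin m → R, LDvd f (∑ j, fj j * b j) → ∀ j, LDvd f (fj j * b j))) ∧
    (∀ z : R, H.deg z < (m : WithBot ℕ) → ∃ a : Fin m → L, z = ∑ j, fj j * C (a j)) ∧
    ((∀ z : R, ∃ (a : Fin m → L) (b : R), z = (∑ j, fj j * C (a j)) + f * b) ∧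
      (∀ a : Fin m → L, LDvd f (∑ j, fj j * C (a j)) → ∀ j, a j = 0)) := by
  obtain ⟨Λ, hΛ, hdeg⟩ := Pind
  obtain ⟨c, hc, hfm⟩ := H.exists_hasLead_of_isLclm hΛ hdeg hι hf
  have hf0 := hfm.ne_zero hc
  have : Nonempty (Fin m) := ⟨⟨0, by omega⟩⟩
  obtain ⟨e, he⟩ := H.exists_sum_mul_eq_one hf hf0 hfj
  have hlow : ∀ j, H.DegLT m (fj j) := fun j => by
    have h0 : fj j ≠ 0 := fun h => hf0 (by rw [hfj j, h, zero_mul])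
    obtain ⟨k, b, hb, hk⟩ := H.exists_hasLead h0
    have hmul := hk.mul (H.hasLead_X_sub_C (α (ι j)))
    rw [← hfj j, iterate_map_one, mul_one] at hmul
    rw [hfm.degree_unique hc hmul hb]
    exact hk.degLT
  have hcomb : ∀ a : Fin m → L, H.DegLT m (∑ j, fj j * C (a j)) := fun a =>
    IsOreExtension.DegLT.sum _ fun j _ => (hlow j).mul_C (a j)
  have hdiv : ∀ b : Fin m → R, ∃ (q : Fin m → R) (a : Fin m → L),
      ∀ j, fj j * b j = f * q j + fj j * C (a j) := fun b => by
    choose q a hqa using fun j => H.exists_eq_X_sub_C_mul_add_C (α (ι j)) (b j)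
    refine ⟨q, a, fun j => ?_⟩
    conv_lhs => rw [hqa j, mul_add, ← mul_assoc, ← hfj j]
  have hspan : ∀ z : R, ∃ (a : Fin m → L) (b : R), z = (∑ j, fj j * C (a j)) + f * b := by
    intro z
    obtain ⟨q, a, hqa⟩ := hdiv fun j => e j * z
    refine ⟨a, ∑ j, q j, ?_⟩
    rw [Finset.mul_sum, add_comm, ← Finset.sum_add_distrib,
      ← Finset.sum_congr rfl fun j _ => hqa j]
    simp only [← mul_assoc]
    rw [← Finset.sum_mul, he, one_mul]
  have hspan_low : ∀ z : R, H.DegLT m z → ∃ a : Fin m → L, z = ∑ j, fj j * C (a j) := by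
    intro z hz
    obtain ⟨a, b, rfl⟩ := hspan z
    have hb := hz.sub (hcomb a)
    rw [add_sub_cancel_left] at hb
    exact ⟨a, by rw [hfm.eq_zero_of_mul_degLT hc hb, mul_zero, add_zero]⟩
  have hind : ∀ a : Fin m → L, LDvd f (∑ j, fj j * C (a j)) → ∀ j, a j = 0 := by
    rintro a ⟨u, hu⟩
    have hu0 := hfm.eq_zero_of_mul_degLT hc (hu ▸ hcomb a)
    rw [hu0, mul_zero] at hu
    exact congrFun (H.eq_zero_of_sum_mul_C_eq_zero hlow hspan_low hu)
  refine ⟨⟨⟨fun j => ⟨_, hfj j⟩, fun z hz => ?_⟩, e, he⟩, ⟨fun z => ?_, ?_⟩, fun z hz =>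
    hspan_low z ((H.deg_lt_iff z m).1 hz), hspan, hind⟩
  · choose b hb using hz
    obtain ⟨q, a, hqa⟩ := hdiv b
    let i₀ : Fin m := ⟨0, by omega⟩
    let i₁ : Fin m := ⟨1, hm1⟩
    have hne : i₀ ≠ i₁ := by simp [i₀, i₁]
    have ha := hind (Pi.single i₀ (a i₀) - Pi.single i₁ (a i₁)) ⟨q i₁ - q i₀, by
      have h0 := (hb i₀).trans (hqa i₀)
      have h1 := (hb i₁).trans (hqa i₁)
      simp only [Pi.sub_apply, Pi.single_apply, map_sub, mul_sub, Finset.sum_sub_distrib,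
        apply_ite C, map_zero, mul_ite, mul_zero, Finset.sum_ite_eq', Finset.mem_univ, if_true]
      rw [sub_eq_sub_iff_add_eq_add, add_comm, ← h0]
      exact h1⟩ i₀
    have ha0 : a i₀ = 0 := by simpa [hne] using ha
    exact ⟨q i₀, by rw [hb i₀, hqa i₀, ha0, map_zero, mul_zero, add_zero]⟩
  · obtain ⟨a, b, h⟩ := hspan z
    exact ⟨fun j => C (a j), b, h⟩
  · rintro b ⟨u, hu⟩ j
    obtain ⟨q, a, hqa⟩ := hdiv b
    have ha := hind a ⟨u - ∑ j, q j, by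
      rw [mul_sub, ← hu, Finset.mul_sum, ← Finset.sum_sub_distrib]
      exact Finset.sum_congr rfl fun j _ => by rw [hqa j, add_sub_cancel_left]⟩ j
    exact ⟨q j, by rw [hqa j, ha, map_zero, mul_zero, add_zero]⟩
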